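/- (Sobolev interpolation for shifted derivatives.) Let N ∈ ℕ. There exists a constant C_N > 0 such that for every Schwartz function g : ℝ³ → ℂ and every ζ ∈ ℝ³, Σ_{|ω| ≤ N} ‖ (∇_v + iζ)^ω g ‖_{L²(ℝ³)} ≤ C_N ( Σ_{|ω| ≤ N+1} ‖ (∇_v + iζ)^ω g ‖_{L²(ℝ³)} )^{N/(N+1)} · ‖g‖_{L²(ℝ³)}^{1/(N+1)}, where for a multi-index ω the operator (∇_v + iζ)^ω is the composition Π_{j=1}^3 (∂_{v_j} + i ζ_j)^{ω_j}. -/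

import Mathlib

open MeasureTheory Real

noncomputable section

/-- ℝ³ as a Euclidean space. -/
abbrev E3 := EuclideanSpace ℝ (Fin 3)

/-- Multi-indices `ω ∈ ℕ³` with `|ω| = ω₁ + ω₂ + ω₃ ≤ N`. -/
def multiIdx (N : ℕ) : Finset (Fin 3 → ℕ) :=
  (Fintype.piFinset fun _ : Fin 3 => Finset.range (N + 1)).filter fun ω => ∑ j, ω j ≤ N

/-- The operator `∂_{v_j} + i ζ_j` acting on functions `ℝ³ → ℂ`. -/
def Yop (ζ : E3) (j : Fin 3) (g : E3 → ℂ) : E3 → ℂ := fun v =>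
  fderiv ℝ g v (EuclideanSpace.single j 1) + Complex.I * (ζ j : ℂ) * g v

/-- The composition `(∇_v + iζ)^ω = Π_j (∂_{v_j} + i ζ_j)^{ω_j}`. -/
def Yiter (ζ : E3) (ω : Fin 3 → ℕ) (g : E3 → ℂ) : E3 → ℂ :=
  (Yop ζ 0)^[ω 0] <| (Yop ζ 1)^[ω 1] <| (Yop ζ 2)^[ω 2] g

/-- The `L²(ℝ³)` norm of a complex-valued function. -/
def l2norm (g : E3 → ℂ) : ℝ := Real.sqrt (∫ v : E3, ‖g v‖ ^ 2)

open scoped LineDeriv SchwartzMap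

/-- The shifted derivative on Schwartz functions. -/
def YS (ζ : E3) (j : Fin 3) (g : SchwartzMap E3 ℂ) : SchwartzMap E3 ℂ :=
  ∂_{(EuclideanSpace.single j (1 : ℝ) : E3)} g + (Complex.I * (ζ j : ℂ)) • g

lemma YS_coe (ζ : E3) (j : Fin 3) (g : SchwartzMap E3 ℂ) :
    (YS ζ j g : E3 → ℂ) = Yop ζ j (g : E3 → ℂ) := by
  funext v
  simp [YS, Yop, SchwartzMap.lineDerivOp_apply_eq_fderiv]

lemma dd_comm (a b : E3) (g : SchwartzMap E3 ℂ) : ∂_{a} (∂_{b} g) = ∂_{b} (∂_{a} g) := by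
  ext x
  have key : ∀ a b : E3, (∂_{a} (∂_{b} g)) x = fderiv ℝ (fderiv ℝ (g : E3 → ℂ)) x a b := by
    intro a b
    rw [SchwartzMap.lineDerivOp_apply_eq_fderiv]
    have h1 : ((∂_{b} g : SchwartzMap E3 ℂ) : E3 → ℂ) = fun y => fderiv ℝ (g : E3 → ℂ) y b := by
      funext y
      rw [SchwartzMap.lineDerivOp_apply_eq_fderiv]
    rw [h1]
    have hd : DifferentiableAt ℝ (fderiv ℝ (g : E3 → ℂ)) x :=
      (SchwartzMap.fderivCLM ℝ E3 ℂ g).differentiableAt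
    rw [fderiv_clm_apply hd (differentiableAt_const b)]
    simp
  rw [key, key]
  have hs : IsSymmSndFDerivAt ℝ (g : E3 → ℂ) x :=
    ((g.smooth 2).contDiffAt).isSymmSndFDerivAt (by simp)
  exact hs a b

lemma YS_comm (ζ : E3) (j k : Fin 3) : Function.Commute (YS ζ j) (YS ζ k) := by
  intro g
  simp only [YS, LineDeriv.lineDerivOp_add, LineDeriv.lineDerivOp_smul, smul_add]
  rw [dd_comm, smul_comm]
  abel

/-- Iterated shifted derivative on Schwartz functions. -/
def YSiter (ζ : E3) (ω : Fin 3 → ℕ) (g : SchwartzMap E3 ℂ) : SchwartzMap E3 ℂ :=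
  (YS ζ 0)^[ω 0] <| (YS ζ 1)^[ω 1] <| (YS ζ 2)^[ω 2] g

lemma YSiter_coe (ζ : E3) (ω : Fin 3 → ℕ) (g : SchwartzMap E3 ℂ) :
    (YSiter ζ ω g : E3 → ℂ) = Yiter ζ ω (g : E3 → ℂ) := by
  have h : ∀ (j : Fin 3) (n : ℕ) (f : SchwartzMap E3 ℂ),
      (((YS ζ j)^[n] f : SchwartzMap E3 ℂ) : E3 → ℂ) = (Yop ζ j)^[n] (f : E3 → ℂ) := by
    intro j n f
    have hs : Function.Semiconj (fun f : SchwartzMap E3 ℂ => (f : E3 → ℂ)) (YS ζ j) (Yop ζ j) :=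
      fun f => YS_coe ζ j f
    exact (hs.iterate_right n) f
  simp only [YSiter, Yiter, h]

lemma YSiter_succ (ζ : E3) (ω : Fin 3 → ℕ) (j : Fin 3) (g : SchwartzMap E3 ℂ) :
    YSiter ζ (ω + Pi.single j 1) g = YS ζ j (YSiter ζ ω g) := by
  have c : ∀ (i k : Fin 3) (n : ℕ) (f : SchwartzMap E3 ℂ),
      (YS ζ i)^[n] (YS ζ k f) = YS ζ k ((YS ζ i)^[n] f) := fun i k n f =>
    ((YS_comm ζ i k).iterate_left n) f
  fin_cases j
  · simp [YSiter, Function.iterate_succ_apply', -Function.iterate_succ]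
  · simp [YSiter, Function.iterate_succ_apply', -Function.iterate_succ, c]
  · simp [YSiter, Function.iterate_succ_apply', -Function.iterate_succ, c]

lemma inner_integrable (f g : SchwartzMap E3 ℂ) :
    Integrable (fun x => inner ℝ (f x) (g x)) :=
  (SchwartzMap.pairing (innerSL ℝ (E := ℂ)) f g).integrable

lemma YS_skew (ζ : E3) (j : Fin 3) (f g : SchwartzMap E3 ℂ) :
    ∫ x, inner ℝ (f x) (YS ζ j g x) = - ∫ x, inner ℝ (YS ζ j f x) (g x) := by
  have h : ∫ x, inner ℝ (f x) ((∂_{(EuclideanSpace.single j (1 : ℝ) : E3)} g) x) =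
      - ∫ x, inner ℝ ((∂_{(EuclideanSpace.single j (1 : ℝ) : E3)} f) x) (g x) :=
    SchwartzMap.integral_bilinear_lineDerivOp_right_eq_neg_left (μ := volume) f g
    (innerSL ℝ (E := ℂ)) (EuclideanSpace.single j (1 : ℝ) : E3)
  have e1 : ∀ x, inner ℝ (f x) (YS ζ j g x) =
      inner ℝ (f x) ((∂_{(EuclideanSpace.single j (1 : ℝ) : E3)} g) x) +
      inner ℝ (f x) (((Complex.I * (ζ j : ℂ)) • g) x) := by
    intro x
    rw [← inner_add_right]; rfl
  have e2 : ∀ x, inner ℝ (YS ζ j f x) (g x) =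
      inner ℝ ((∂_{(EuclideanSpace.single j (1 : ℝ) : E3)} f) x) (g x) -
      inner ℝ (f x) (((Complex.I * (ζ j : ℂ)) • g) x) := by
    intro x
    have : YS ζ j f x = (∂_{(EuclideanSpace.single j (1 : ℝ) : E3)} f) x +
      ((Complex.I * (ζ j : ℂ)) * f x) := rfl
    rw [this, inner_add_left, sub_eq_add_neg]
    congr 1
    simp [Complex.inner]
    ring
  simp only [e1, e2]
  rw [integral_add (inner_integrable _ _) (inner_integrable _ _),
    integral_sub (inner_integrable _ _) (inner_integrable _ _), h]
  ring

lemma l2_cs (f g : SchwartzMap E3 ℂ) :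
    |∫ x, inner ℝ (f x) (g x)| ≤ l2norm f * l2norm g := by
  have hpq : (2 : ℝ).HolderConjugate 2 := Real.HolderConjugate.two_two
  have h := integral_mul_norm_le_Lp_mul_Lq (μ := (volume : Measure E3)) hpq
    (f.memLp (ENNReal.ofReal 2) volume) (g.memLp (ENNReal.ofReal 2) volume)
  have h2 : |∫ x, inner ℝ (f x) (g x)| ≤ ∫ x, ‖f x‖ * ‖g x‖ := by
    rw [← Real.norm_eq_abs]
    refine norm_integral_le_of_norm_le ?_ (Filter.Eventually.of_forall fun x => norm_inner_le_norm _ _)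
    exact (f.memLp 2 volume).norm.integrable_mul (g.memLp 2 volume).norm
  refine h2.trans (h.trans (le_of_eq ?_))
  simp only [l2norm, Real.sqrt_eq_rpow, Real.rpow_two]

lemma l2_sq (f : SchwartzMap E3 ℂ) : l2norm f ^ 2 = ∫ x, inner ℝ (f x) (f x) := by
  rw [l2norm, Real.sq_sqrt (integral_nonneg fun x => by positivity)]
  simp

lemma YS_interp (ζ : E3) (j : Fin 3) (f : SchwartzMap E3 ℂ) :
    l2norm (YS ζ j f) ^ 2 ≤ l2norm f * l2norm (YS ζ j (YS ζ j f)) := by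
  rw [l2_sq]
  have h := YS_skew ζ j f (YS ζ j f)
  refine le_trans ?_ (l2_cs f (YS ζ j (YS ζ j f)))
  rw [h, abs_neg]
  exact le_abs_self _

lemma mem_multiIdx {N : ℕ} {ω : Fin 3 → ℕ} : ω ∈ multiIdx N ↔ ∑ j, ω j ≤ N := by
  simp only [multiIdx, Finset.mem_filter, Fintype.mem_piFinset, Finset.mem_range,
    and_iff_right_iff_imp]
  intro h j
  have := Finset.single_le_sum (f := ω) (fun i _ => Nat.zero_le _) (Finset.mem_univ j)
  omega

lemma multiIdx_nonempty (N : ℕ) : (multiIdx N).Nonempty := ⟨0, mem_multiIdx.2 (by simp)⟩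

/-- Maximum of the norms of the shifted derivatives of order at most `k`. -/
def maxNorm (ζ : E3) (g : SchwartzMap E3 ℂ) (k : ℕ) : ℝ :=
  (multiIdx k).sup' (multiIdx_nonempty k) fun ω => l2norm (YSiter ζ ω g)

lemma le_maxNorm (ζ : E3) (g : SchwartzMap E3 ℂ) {k : ℕ} {ω : Fin 3 → ℕ} (h : ∑ j, ω j ≤ k) :
    l2norm (YSiter ζ ω g) ≤ maxNorm ζ g k :=
  Finset.le_sup' (fun ω => l2norm (YSiter ζ ω g)) (mem_multiIdx.2 h)

lemma l2norm_nonneg (f : E3 → ℂ) : 0 ≤ l2norm f := Real.sqrt_nonneg _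

lemma maxNorm_nonneg (ζ : E3) (g : SchwartzMap E3 ℂ) (k : ℕ) : 0 ≤ maxNorm ζ g k :=
  (l2norm_nonneg _).trans (le_maxNorm ζ g (ω := 0) (by simp))

lemma maxNorm_zero (ζ : E3) (g : SchwartzMap E3 ℂ) : maxNorm ζ g 0 = l2norm g := by
  obtain ⟨ω, hω, h⟩ := Finset.exists_mem_eq_sup' (multiIdx_nonempty 0)
    (fun ω => l2norm (YSiter ζ ω g))
  rw [maxNorm, h]
  have : ω = 0 := by
    have := mem_multiIdx.1 hω
    funext j
    have h2 := Finset.single_le_sum (f := ω) (fun i _ => Nat.zero_le _) (Finset.mem_univ j)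
    simp only [Pi.zero_apply]; omega
  subst this
  rfl

lemma maxNorm_logconvex (ζ : E3) (g : SchwartzMap E3 ℂ) (k : ℕ) :
    maxNorm ζ g (k + 1) ^ 2 ≤ maxNorm ζ g k * maxNorm ζ g (k + 2) := by
  obtain ⟨ω, hω, h⟩ := Finset.exists_mem_eq_sup' (multiIdx_nonempty (k + 1))
    (fun ω => l2norm (YSiter ζ ω g))
  rw [maxNorm, h]
  have hs := mem_multiIdx.1 hω
  by_cases h0 : ω = 0
  · subst h0
    rw [sq]
    exact mul_le_mul (le_maxNorm ζ g (by simp)) (le_maxNorm ζ g (by simp)) (l2norm_nonneg _)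
      (maxNorm_nonneg _ _ _)
  · obtain ⟨j, hj⟩ := Function.ne_iff.1 h0
    obtain ⟨ω', rfl⟩ : ∃ ω' : Fin 3 → ℕ, ω = ω' + Pi.single j 1 := by
      refine ⟨ω - Pi.single j 1, (tsub_add_cancel_of_le ?_).symm⟩
      intro i
      by_cases hij : i = j
      · subst hij
        simpa [Nat.one_le_iff_ne_zero] using hj
      · simp [hij]
    have e : ∀ w : Fin 3 → ℕ, ∑ i, (w + Pi.single j 1 : Fin 3 → ℕ) i = ∑ i, w i + 1 := by
      intro w
      simp only [Pi.add_apply, Finset.sum_add_distrib]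
      simp
    have hi := YS_interp ζ j (YSiter ζ ω' g)
    rw [← YSiter_succ, ← YSiter_succ] at hi
    rw [e] at hs
    exact hi.trans (mul_le_mul (le_maxNorm ζ g (by omega))
      (le_maxNorm ζ g (by rw [e, e]; omega)) (l2norm_nonneg _) (maxNorm_nonneg _ _ _))

lemma pow_interp (K : ℕ → ℝ) (h0 : ∀ k, 0 ≤ K k) (h : ∀ k, K (k + 1) ^ 2 ≤ K k * K (k + 2))
    (N : ℕ) : K N ^ (N + 1) ≤ K (N + 1) ^ N * K 0 := by
  induction N with
  | zero => simp
  | succ n ih =>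
    rcases (h0 (n + 1)).eq_or_lt with hz | hp
    · rw [← hz, zero_pow (by omega)]
      exact mul_nonneg (pow_nonneg (h0 _) _) (h0 _)
    · refine le_of_mul_le_mul_left ?_ (pow_pos hp n)
      calc K (n + 1) ^ n * K (n + 1) ^ (n + 1 + 1) = (K (n + 1) ^ 2) ^ (n + 1) := by ring
        _ ≤ (K n * K (n + 2)) ^ (n + 1) := pow_le_pow_left₀ (sq_nonneg _) (h n) _
        _ = K n ^ (n + 1) * K (n + 2) ^ (n + 1) := mul_pow _ _ _
        _ ≤ (K (n + 1) ^ n * K 0) * K (n + 2) ^ (n + 1) :=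
          mul_le_mul_of_nonneg_right ih (pow_nonneg (h0 _) _)
        _ = _ := by ring

lemma rpow_interp (a b c : ℝ) (ha : 0 ≤ a) (hb : 0 ≤ b) (hc : 0 ≤ c) (N : ℕ)
    (h : a ^ (N + 1) ≤ b ^ N * c) :
    a ≤ b ^ ((N : ℝ) / (N + 1)) * c ^ ((1 : ℝ) / (N + 1)) := by
  have hN : ((N : ℝ) + 1) ≠ 0 := by positivity
  refine le_of_pow_le_pow_left₀ (n := N + 1) (by omega) (by positivity) (h.trans (le_of_eq ?_))
  rw [mul_pow, ← Real.rpow_mul_natCast hb, ← Real.rpow_mul_natCast hc]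
  push_cast
  rw [div_mul_cancel₀ _ hN, div_mul_cancel₀ _ hN, Real.rpow_natCast, Real.rpow_one]

/-- **Sobolev interpolation for shifted derivatives.**  For every `N ∈ ℕ` there is
`C_N > 0` such that for every Schwartz `g : ℝ³ → ℂ` and every `ζ ∈ ℝ³`,
`Σ_{|ω| ≤ N} ‖(∇_v + iζ)^ω g‖_{L²}
  ≤ C_N (Σ_{|ω| ≤ N+1} ‖(∇_v + iζ)^ω g‖_{L²})^{N/(N+1)} ‖g‖_{L²}^{1/(N+1)}`. -/
theorem sobolev_interpolation_shifted_derivatives (N : ℕ) :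
    ∃ C > 0, ∀ (g : SchwartzMap E3 ℂ) (ζ : E3),
      (∑ ω ∈ multiIdx N, l2norm (Yiter ζ ω (g : E3 → ℂ))) ≤
        C * (∑ ω ∈ multiIdx (N + 1), l2norm (Yiter ζ ω (g : E3 → ℂ))) ^ ((N : ℝ)/(N + 1)) *
          l2norm (g : E3 → ℂ) ^ ((1 : ℝ)/(N + 1)) := by
  refine ⟨(multiIdx N).card, by exact_mod_cast (multiIdx_nonempty N).card_pos, fun g ζ => ?_⟩
  simp only [← YSiter_coe]
  have h1 := rpow_interp _ _ _ (maxNorm_nonneg ζ g N) (maxNorm_nonneg ζ g (N + 1))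
    (maxNorm_nonneg ζ g 0) N
    (pow_interp (maxNorm ζ g) (maxNorm_nonneg ζ g) (maxNorm_logconvex ζ g) N)
  rw [maxNorm_zero] at h1
  have h2 : maxNorm ζ g (N + 1) ≤ ∑ ω ∈ multiIdx (N + 1), l2norm (YSiter ζ ω g) :=
    Finset.sup'_le _ _ fun ω hω =>
      Finset.single_le_sum (f := fun ω => l2norm (YSiter ζ ω g))
        (fun i _ => l2norm_nonneg _) hω
  have h3 : ∑ ω ∈ multiIdx N, l2norm (YSiter ζ ω g) ≤ (multiIdx N).card * maxNorm ζ g N := by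
    rw [← nsmul_eq_mul]
    exact Finset.sum_le_card_nsmul _ _ _ fun ω hω => le_maxNorm ζ g (mem_multiIdx.1 hω)
  refine h3.trans ?_
  rw [mul_assoc]
  refine mul_le_mul_of_nonneg_left (h1.trans ?_) (by positivity)
  refine mul_le_mul_of_nonneg_right ?_ (Real.rpow_nonneg (l2norm_nonneg _) _)
  exact Real.rpow_le_rpow (maxNorm_nonneg _ _ _) h2 (by positivity)
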